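/- (Theorem 1, accuracy-bound comparison.) Fix an integer n ≥ 2 and define Q_n(ε) = binEntropy(ε) + ε·log(n−1). Let Y, S, X be random variables on a probability space taking values in finite (discrete measurable) spaces. Assume I(Y ; S | X) > 0, and assume ε₁, ε₂ ∈ [0, 1 − 1/n] satisfy Q_n(ε₁) = H(Y) − I(Y ; X) and Q_n(ε₂) = H(Y) − I(Y ; (S, X)). Then ε₂ < ε₁, and hence the accuracy upper bounds c₁ := 1 − ε₁ and c₂ := 1 − ε₂ satisfy c₂ > c₁; i.e., predicting with the correct self-supervised label strictly improves the upper bound on classification accuracy. -/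

import Mathlib

open MeasureTheory ProbabilityTheory Real

/-- Shannon entropy (natural logarithm) of a discrete random variable `A`
taking values in a finite type. The convention `0 * log 0 = 0` holds
automatically since `Real.log 0 = 0`. -/
noncomputable def entropy {Ω α : Type*} [MeasurableSpace Ω] [Fintype α]
    (μ : Measure Ω) (A : Ω → α) : ℝ :=
  -∑ a : α, (μ (A ⁻¹' {a})).toReal * Real.log (μ (A ⁻¹' {a})).toReal

/-- Mutual information `I(A;B) = H(A) + H(B) - H(A,B)`. -/
noncomputable def mutualInfo {Ω α β : Type*} [MeasurableSpace Ω] [Fintype α] [Fintype β]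
    (μ : Measure Ω) (A : Ω → α) (B : Ω → β) : ℝ :=
  entropy μ A + entropy μ B - entropy μ (fun ω => (A ω, B ω))

/-- Conditional mutual information `I(A;B|C) = ∑ c, P(C = c) * I(A;B | C = c)`,
where the inner mutual information is computed under the conditional measure. -/
noncomputable def condMutualInfo {Ω α β γ : Type*} [MeasurableSpace Ω]
    [Fintype α] [Fintype β] [Fintype γ]
    (μ : Measure Ω) (A : Ω → α) (B : Ω → β) (C : Ω → γ) : ℝ :=
  ∑ c : γ, (μ (C ⁻¹' {c})).toReal * mutualInfo (μ[|C ⁻¹' {c}]) A B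

/-- The probabilities of the events `A = a ∧ C = c` add up to the probability of `C = c`. -/
theorem sum_measureReal_prodMk_preimage {Ω α γ : Type*} [MeasurableSpace Ω]
    [Fintype α] [MeasurableSpace α] [MeasurableSingletonClass α]
    (μ : Measure Ω) [IsFiniteMeasure μ] {A : Ω → α} (hA : Measurable A) (C : Ω → γ) (c : γ) :
    ∑ a, μ.real ((fun ω => (A ω, C ω)) ⁻¹' {(a, c)}) = μ.real (C ⁻¹' {c}) := by
  have hpre (a : α) : (fun ω => (A ω, C ω)) ⁻¹' {(a, c)} = A ⁻¹' {a} ∩ C ⁻¹' {c} := by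
    ext ω
    simp
  have hsum := sum_measureReal_preimage_singleton (μ := μ.restrict (C ⁻¹' {c})) (f := A)
    Finset.univ fun a _ => hA (measurableSet_singleton a)
  simpa [hpre, measureReal_restrict_apply, hA (measurableSet_singleton _)] using hsum

/-- The contribution of `C = c` to the conditional entropy of `A` given `C`. -/
theorem measureReal_mul_entropy_cond {Ω α γ : Type*} [MeasurableSpace Ω]
    [Fintype α] [MeasurableSpace α] [MeasurableSingletonClass α]
    [MeasurableSpace γ] [MeasurableSingletonClass γ]
    (μ : Measure Ω) [IsFiniteMeasure μ] {A : Ω → α} {C : Ω → γ}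
    (hA : Measurable A) (hC : Measurable C) (c : γ) :
    μ.real (C ⁻¹' {c}) * entropy (μ[|C ⁻¹' {c}]) A =
      μ.real (C ⁻¹' {c}) * log (μ.real (C ⁻¹' {c})) -
        ∑ a, μ.real ((fun ω => (A ω, C ω)) ⁻¹' {(a, c)}) *
          log (μ.real ((fun ω => (A ω, C ω)) ⁻¹' {(a, c)})) := by
  have hsum := sum_measureReal_prodMk_preimage μ hA C c
  have hcond (a : α) : (μ[|C ⁻¹' {c}]).real (A ⁻¹' {a}) =
      (μ.real (C ⁻¹' {c}))⁻¹ * μ.real ((fun ω => (A ω, C ω)) ⁻¹' {(a, c)}) := by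
    rw [measureReal_def, cond_apply (hC (measurableSet_singleton c)), ENNReal.toReal_mul,
      ENNReal.toReal_inv, ← measureReal_def, ← measureReal_def]
    congr 2
    ext ω
    simp [and_comm]
  simp only [entropy, ← measureReal_def, hcond]
  generalize μ.real (C ⁻¹' {c}) = p at hsum ⊢
  have hnonneg (a : α) : 0 ≤ μ.real ((fun ω => (A ω, C ω)) ⁻¹' {(a, c)}) := measureReal_nonneg
  rw [mul_neg, Finset.mul_sum, ← Finset.sum_neg_distrib, ← hsum, Finset.sum_mul,
    ← Finset.sum_sub_distrib]
  refine Finset.sum_congr rfl fun a ha => ?_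
  have hle := Finset.single_le_sum (fun a _ => hnonneg a) ha
  rw [hsum] at hle ⊢
  have hq := hnonneg a
  generalize μ.real ((fun ω => (A ω, C ω)) ⁻¹' {(a, c)}) = q at hle hq ⊢
  obtain rfl | hq0 := hq.eq_or_lt
  · simp
  have hp0 : 0 < p := hq0.trans_le hle
  rw [log_mul (inv_pos.2 hp0).ne' hq0.ne', log_inv]
  field_simp
  ring

/-- Chain rule for entropy: `H(A,C) = H(C) + H(A|C)`. -/
theorem entropy_prodMk {Ω α γ : Type*} [MeasurableSpace Ω]
    [Fintype α] [MeasurableSpace α] [MeasurableSingletonClass α]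
    [Fintype γ] [MeasurableSpace γ] [MeasurableSingletonClass γ]
    (μ : Measure Ω) [IsFiniteMeasure μ] {A : Ω → α} {C : Ω → γ}
    (hA : Measurable A) (hC : Measurable C) :
    entropy μ (fun ω => (A ω, C ω)) =
      entropy μ C + ∑ c, μ.real (C ⁻¹' {c}) * entropy (μ[|C ⁻¹' {c}]) A := by
  simp only [measureReal_mul_entropy_cond μ hA hC, Finset.sum_sub_distrib]
  simp only [entropy, ← measureReal_def, Fintype.sum_prod_type_right]
  ring

/-- Relabelling the values of a random variable does not change its entropy. -/
theorem entropy_equiv_comp {Ω α β : Type*} [MeasurableSpace Ω] [Fintype α] [Fintype β]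
    (μ : Measure Ω) (A : Ω → α) (e : α ≃ β) :
    entropy μ (fun ω => e (A ω)) = entropy μ A := by
  have hpre (a : α) : (fun ω => e (A ω)) ⁻¹' {e a} = A ⁻¹' {a} := by
    ext ω
    simp
  simp only [entropy, ← e.sum_comp, hpre]

/-- Chain rule for mutual information: `I(A;(B,C)) = I(A;C) + I(A;B|C)`. -/
theorem mutualInfo_prodMk {Ω α β γ : Type*} [MeasurableSpace Ω]
    [Fintype α] [MeasurableSpace α] [MeasurableSingletonClass α]
    [Fintype β] [MeasurableSpace β] [MeasurableSingletonClass β]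
    [Fintype γ] [MeasurableSpace γ] [MeasurableSingletonClass γ]
    (μ : Measure Ω) [IsFiniteMeasure μ] {A : Ω → α} {B : Ω → β} {C : Ω → γ}
    (hA : Measurable A) (hB : Measurable B) (hC : Measurable C) :
    mutualInfo μ A (fun ω => (B ω, C ω)) = mutualInfo μ A C + condMutualInfo μ A B C := by
  have hassoc := entropy_equiv_comp μ (fun ω => ((A ω, B ω), C ω)) (Equiv.prodAssoc α β γ)
  simp only [Equiv.prodAssoc_apply] at hassoc
  simp only [mutualInfo, condMutualInfo, ← measureReal_def, mul_sub, mul_add,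
    Finset.sum_sub_distrib, Finset.sum_add_distrib, hassoc, entropy_prodMk μ hA hC,
    entropy_prodMk μ hB hC, entropy_prodMk μ (hA.prodMk hB) hC]
  ring

/-- Theorem 1 (accuracy-bound comparison): if `I(Y ; S | X) > 0` and
`ε₁, ε₂ ∈ [0, 1 − 1/n]` satisfy `Q_n(ε₁) = H(Y) − I(Y;X)` and
`Q_n(ε₂) = H(Y) − I(Y;(S,X))` where `Q_n(ε) = binEntropy(ε) + ε·log(n−1)`,
then `ε₂ < ε₁`, and so the accuracy upper bounds `c₁ = 1 − ε₁` and
`c₂ = 1 − ε₂` satisfy `c₁ < c₂`. -/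
theorem accuracy_bound_strict_improvement
    {Ω 𝒴 𝒮 𝒳 : Type*} [MeasurableSpace Ω]
    [Fintype 𝒴] [MeasurableSpace 𝒴] [MeasurableSingletonClass 𝒴]
    [Fintype 𝒮] [MeasurableSpace 𝒮] [MeasurableSingletonClass 𝒮]
    [Fintype 𝒳] [MeasurableSpace 𝒳] [MeasurableSingletonClass 𝒳]
    (μ : Measure Ω) [IsProbabilityMeasure μ]
    (Y : Ω → 𝒴) (S : Ω → 𝒮) (X : Ω → 𝒳)
    (hY : Measurable Y) (hS : Measurable S) (hX : Measurable X)
    (n : ℕ) (hn : 2 ≤ n)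
    (hCMI : 0 < condMutualInfo μ Y S X)
    (ε₁ ε₂ : ℝ)
    (hε₁ : ε₁ ∈ Set.Icc (0 : ℝ) (1 - 1 / (n : ℝ)))
    (hε₂ : ε₂ ∈ Set.Icc (0 : ℝ) (1 - 1 / (n : ℝ)))
    (h₁ : Real.binEntropy ε₁ + ε₁ * Real.log ((n : ℝ) - 1) =
      entropy μ Y - mutualInfo μ Y X)
    (h₂ : Real.binEntropy ε₂ + ε₂ * Real.log ((n : ℝ) - 1) =
      entropy μ Y - mutualInfo μ Y (fun ω => (S ω, X ω))) :
    ε₂ < ε₁ ∧ 1 - ε₁ < 1 - ε₂ := by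
  have hchain := mutualInfo_prodMk μ hY hS hX
  have hQ (ε : ℝ) : qaryEntropy n ε = binEntropy ε + ε * log ((n : ℝ) - 1) := by
    simp [qaryEntropy, add_comm]
  have hlt : ε₂ < ε₁ := by
    rw [← (qaryEntropy_strictMonoOn hn).lt_iff_lt hε₂ hε₁, hQ, hQ, h₁, h₂]
    linarith
  exact ⟨hlt, sub_lt_sub_left hlt 1⟩
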